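/- Consider the (VS-SQN) scheme under the stated assumptions with stepsize γ_k = 1/(L·λ̄) for all k ≥ 0, with (N_k)_{k≥0} an increasing sequence of positive integers such that Σ_{k=0}^∞ 1/N_k < ∞ and N_0 > 2ν₁²λ̄/(τ²λ̲). Then f(x_k) → f(x*) almost surely as k → ∞, and consequently ‖x_k − x*‖² → 0 almost surely. -/

import Mathlib

open MeasureTheory Filter
open scoped RealInnerProductSpace Topology

noncomputable section

section Deterministic

variable {E : Type*} [NormedAddCommGroup E] [InnerProductSpace ℝ E]

/-- Along a line, a function with a gradient has the expected derivative. -/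
theorem HasGradientAt.hasDerivAt_line [CompleteSpace E] {f : E → ℝ} {g x d : E} {t : ℝ}
    (h : HasGradientAt f g (x + t • d)) :
    HasDerivAt (fun s : ℝ => f (x + s • d)) ⟪g, d⟫ t := by
  have h1 : HasDerivAt (fun s : ℝ => x + s • d) d t := by
    simpa using ((hasDerivAt_id t).smul_const d).const_add x
  simpa [Function.comp_def] using! h.hasFDerivAt.comp_hasDerivAt t h1

/-- The first-order lower bound satisfied by a strongly convex function. -/
theorem StrongConvexOn.add_inner_add_le [CompleteSpace E] {f : E → ℝ} {τ : ℝ} {g x : E}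
    (hsc : StrongConvexOn Set.univ τ f) (hg : HasGradientAt f g x) (y : E) :
    f x + ⟪g, y - x⟫ + τ / 2 * ‖y - x‖ ^ 2 ≤ f y := by
  have h0 : HasDerivAt (fun s : ℝ => f (x + s • (y - x))) ⟪g, y - x⟫ 0 :=
    HasGradientAt.hasDerivAt_line (by simpa using hg)
  have hl := h0.tendsto_slope_zero_right
  have hr : Tendsto (fun t : ℝ => f y - f x - (1 - t) * (τ / 2 * ‖y - x‖ ^ 2)) (𝓝[>] 0)
      (𝓝 (f y - f x - (1 - 0) * (τ / 2 * ‖y - x‖ ^ 2))) := by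
    refine Tendsto.mono_left ?_ nhdsWithin_le_nhds
    exact Continuous.tendsto (by fun_prop) 0
  have hle := le_of_tendsto_of_tendsto hl hr (by
    filter_upwards [Ioo_mem_nhdsGT (zero_lt_one' ℝ)] with t ht
    have h := hsc.2 (Set.mem_univ x) (Set.mem_univ y) (sub_nonneg.2 ht.2.le) ht.1.le
      (sub_add_cancel 1 t)
    have e : (1 - t) • x + t • y = x + t • (y - x) := by module
    rw [e, norm_sub_rev x y] at h
    simp only [smul_eq_mul, zero_add, zero_smul, add_zero] at h ⊢
    rw [inv_mul_le_iff₀ ht.1]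
    linarith)
  linarith

/-- The quadratic upper bound for a function with Lipschitz gradient. -/
theorem le_add_inner_add_of_lipschitz_gradient [CompleteSpace E] {f : E → ℝ} {gf : E → E} {L : ℝ}
    (hgrad : ∀ z, HasGradientAt f (gf z) z)
    (hlip : ∀ z z', ‖gf z - gf z'‖ ≤ L * ‖z - z'‖) (x d : E) :
    f (x + d) ≤ f x + ⟪gf x, d⟫ + L / 2 * ‖d‖ ^ 2 := by
  have hd : ∀ t : ℝ, HasDerivAt
      (fun s : ℝ => f (x + s • d) - s * ⟪gf x, d⟫ - L / 2 * ‖d‖ ^ 2 * s ^ 2)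
      (⟪gf (x + t • d), d⟫ - ⟪gf x, d⟫ - L / 2 * ‖d‖ ^ 2 * (2 * t)) t := fun t => by
    have h1 := (hgrad (x + t • d)).hasDerivAt_line
    have h2 := (hasDerivAt_id t).mul_const ⟪gf x, d⟫
    have h3 := (hasDerivAt_pow 2 t).const_mul (L / 2 * ‖d‖ ^ 2)
    simpa [Pi.sub_def] using! (h1.sub h2).sub h3
  have hanti := antitoneOn_of_deriv_nonpos (convex_Icc (0 : ℝ) 1)
    (fun t _ => (hd t).continuousAt.continuousWithinAt)
    (fun t _ => (hd t).differentiableAt.differentiableWithinAt) (fun t ht => by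
      rw [interior_Icc] at ht
      rw [(hd t).deriv, ← inner_sub_left]
      have h1 := real_inner_le_norm (gf (x + t • d) - gf x) d
      have h2 : ‖gf (x + t • d) - gf x‖ ≤ L * (t * ‖d‖) := by
        simpa [norm_smul, abs_of_pos ht.1] using hlip (x + t • d) x
      nlinarith [mul_le_mul_of_nonneg_right h2 (norm_nonneg d)])
  have h := hanti (Set.left_mem_Icc.2 zero_le_one) (Set.right_mem_Icc.2 zero_le_one) zero_le_one
  simp only [one_smul, one_mul, one_pow, zero_smul, zero_mul, add_zero] at h
  linarith

/-- The Polyak–Łojasiewicz inequality for a strongly convex function. -/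
theorem StrongConvexOn.two_mul_mul_sub_le_norm_sq [CompleteSpace E] {f : E → ℝ} {τ : ℝ} {g x : E}
    (hτ : 0 < τ) (hsc : StrongConvexOn Set.univ τ f) (hg : HasGradientAt f g x) (y : E) :
    2 * τ * (f x - f y) ≤ ‖g‖ ^ 2 := by
  have h := hsc.add_inner_add_le hg y
  have h1 : 0 ≤ ‖g + τ • (y - x)‖ ^ 2 := sq_nonneg _
  rw [norm_add_sq_real, inner_smul_right, norm_smul, Real.norm_of_nonneg hτ.le] at h1
  nlinarith

/-- A symmetric operator `T` with `0 ≤ T ≤ b` satisfies `T² ≤ b T`. -/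
theorem LinearMap.IsSymmetric.norm_sq_le_mul_inner {T : E →ₗ[ℝ] E} (hT : T.IsSymmetric) {b : ℝ}
    (hb : 0 < b) (h0 : ∀ v, 0 ≤ ⟪T v, v⟫) (h1 : ∀ v, ⟪T v, v⟫ ≤ b * ‖v‖ ^ 2) (u : E) :
    ‖T u‖ ^ 2 ≤ b * ⟪T u, u⟫ := by
  have h := h0 (b • u - T u)
  have h2 := h1 (T u)
  have h3 : ⟪T (T u), u⟫ = ‖T u‖ ^ 2 := by rw [hT, real_inner_self_eq_norm_sq]
  simp only [map_sub, map_smul, inner_sub_left, inner_sub_right, inner_smul_left,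
    inner_smul_right, real_inner_self_eq_norm_sq, h3, conj_trivial] at h
  nlinarith

/-- One-step decrease of a preconditioned gradient step with step size `1 / (L b)` and additive
gradient error `w`. -/
theorem sub_le_of_preconditioned_gradient_step [CompleteSpace E] {f : E → ℝ} {gf : E → E}
    {τ L a b : ℝ} (hτ : 0 < τ) (hL : 0 < L) (ha : 0 < a) (hb : 0 < b)
    (hsc : StrongConvexOn Set.univ τ f) (hgrad : ∀ z, HasGradientAt f (gf z) z)
    (hlip : ∀ z z', ‖gf z - gf z'‖ ≤ L * ‖z - z'‖) {T : E →ₗ[ℝ] E} (hT : T.IsSymmetric)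
    (hTb : ∀ v, a * ‖v‖ ^ 2 ≤ ⟪T v, v⟫ ∧ ⟪T v, v⟫ ≤ b * ‖v‖ ^ 2) (x w y : E) :
    f (x - (1 / (L * b)) • T (gf x + w)) - f y
      ≤ (1 - a * τ / (L * b)) * (f x - f y) + 1 / (2 * L) * ‖w‖ ^ 2 := by
  have h1 := le_add_inner_add_of_lipschitz_gradient hgrad hlip x
    (-((1 / (L * b)) • T (gf x + w)))
  have h2 := hT.norm_sq_le_mul_inner hb
    (fun v => (by positivity : 0 ≤ a * ‖v‖ ^ 2).trans (hTb v).1) (fun v => (hTb v).2) (gf x + w)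
  have h3 := (hTb (gf x)).1
  have h4 := (hTb w).2
  have h5 := hsc.two_mul_mul_sub_le_norm_sq hτ (hgrad x) y
  rw [← sub_eq_add_neg, norm_neg, inner_neg_right, norm_smul, inner_smul_right, mul_pow,
    Real.norm_of_nonneg (by positivity)] at h1
  have hsym : ⟪T w, gf x⟫ = ⟪T (gf x), w⟫ := by rw [hT, real_inner_comm]
  have h6 : ⟪gf x, T (gf x + w)⟫ = ⟪T (gf x), gf x⟫ + ⟪T (gf x), w⟫ := by
    rw [← hT, inner_add_right]
  have h7 : ⟪T (gf x + w), gf x + w⟫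
      = ⟪T (gf x), gf x⟫ + 2 * ⟪T (gf x), w⟫ + ⟪T w, w⟫ := by
    rw [map_add, inner_add_left, inner_add_right, inner_add_right, hsym]; ring
  rw [h6] at h1
  rw [h7] at h2
  have h8 : L / 2 * ((1 / (L * b)) ^ 2 * ‖T (gf x + w)‖ ^ 2) ≤ 1 / (L * b) / 2 *
      (⟪T (gf x), gf x⟫ + 2 * ⟪T (gf x), w⟫ + ⟪T w, w⟫) := by
    calc L / 2 * ((1 / (L * b)) ^ 2 * ‖T (gf x + w)‖ ^ 2)
        ≤ L / 2 * ((1 / (L * b)) ^ 2 *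
          (b * (⟪T (gf x), gf x⟫ + 2 * ⟪T (gf x), w⟫ + ⟪T w, w⟫))) := by gcongr
      _ = _ := by field_simp
  have h9 : 1 / (L * b) / 2 * (a * (2 * τ * (f x - f y))) ≤
      1 / (L * b) / 2 * ⟪T (gf x), gf x⟫ := by
    gcongr
    exact (mul_le_mul_of_nonneg_left h5 ha.le).trans h3
  have h10 : 1 / (L * b) / 2 * ⟪T w, w⟫ ≤ 1 / (L * b) / 2 * (b * ‖w‖ ^ 2) := by gcongr
  have e1 : 1 / (L * b) / 2 * (a * (2 * τ * (f x - f y))) = a * τ / (L * b) * (f x - f y) := by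
    field_simp
  have e2 : 1 / (L * b) / 2 * (b * ‖w‖ ^ 2) = 1 / (2 * L) * ‖w‖ ^ 2 := by field_simp
  linarith

end Deterministic

/-- A nonnegative sequence that contracts up to summable relative and absolute errors is
summable. -/
theorem summable_of_contracting_recursion {e s : ℕ → ℝ} {q A B : ℝ} (hq : 0 < q)
    (hB : 0 ≤ B) (he : ∀ k, 0 ≤ e k) (hs0 : ∀ k, 0 ≤ s k) (hs : Summable s)
    (h : ∀ k, e (k + 1) ≤ (1 - q) * e k + s k * (A * e k + B)) : Summable e := by
  have h0 : Tendsto (fun k => s k * A) atTop (𝓝 0) := by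
    simpa using hs.tendsto_atTop_zero.mul_const A
  obtain ⟨K, hK⟩ := eventually_atTop.1 (h0.eventually_le_const (half_pos hq))
  rw [← summable_nat_add_iff K]
  have hs' : Summable fun k => s (k + K) := (summable_nat_add_iff K).2 hs
  have key : ∀ m, q / 2 * ∑ k ∈ Finset.range m, e (k + K) ≤
      e K - e (m + K) + B * ∑ k ∈ Finset.range m, s (k + K) := fun m => by
    induction m with
    | zero => simp
    | succ m ih =>
      rw [Finset.sum_range_succ, Finset.sum_range_succ]
      have h1 := h (m + K)
      have h2 := mul_le_mul_of_nonneg_right (hK (m + K) (by lia)) (he (m + K))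
      rw [show m + 1 + K = m + K + 1 by ring]
      linarith
  refine summable_of_sum_range_le (c := (e K + B * ∑' k, s (k + K)) / (q / 2))
    (fun k => he _) fun m => ?_
  rw [le_div_iff₀' (half_pos hq)]
  have h1 := hs'.sum_le_tsum (Finset.range m) fun k _ => hs0 _
  linarith [key m, he (m + K), mul_le_mul_of_nonneg_left h1 hB]

/-- Nonnegative integrable functions with summable integrals tend to zero almost everywhere. -/
theorem ae_tendsto_zero_of_summable_integral {Ω : Type*} {m0 : MeasurableSpace Ω} {μ : Measure Ω}
    {D : ℕ → Ω → ℝ} (hD : ∀ k, Integrable (D k) μ) (hD0 : ∀ k ω, 0 ≤ D k ω)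
    (hs : Summable fun k => ∫ ω, D k ω ∂μ) :
    ∀ᵐ ω ∂μ, Tendsto (fun k => D k ω) atTop (𝓝 0) := by
  have hmeas : ∀ k, AEMeasurable (fun ω => ENNReal.ofReal (D k ω)) μ :=
    fun k => (hD k).1.aemeasurable.ennreal_ofReal
  have hfin : ∫⁻ ω, ∑' k, ENNReal.ofReal (D k ω) ∂μ ≠ ⊤ := by
    rw [lintegral_tsum hmeas]
    simp_rw [← ofReal_integral_eq_lintegral_ofReal (hD _) (ae_of_all μ (hD0 _))]
    exact hs.tsum_ofReal_ne_top
  filter_upwards [ae_lt_top' (AEMeasurable.tsum hmeas) hfin] with ω hω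
  have h := (ENNReal.tendsto_toReal ENNReal.zero_ne_top).comp
    (ENNReal.tendsto_atTop_zero_of_tsum_ne_top hω.ne)
  simpa [Function.comp_def, ENNReal.toReal_ofReal (hD0 _ ω)] using h

/-- The solution of a linear system with measurable data is measurable, provided the matrix is
almost surely nonsingular. -/
theorem aemeasurable_of_toEuclideanLin_eq {n : ℕ} {Ω : Type*} {m0 : MeasurableSpace Ω}
    {μ : Measure Ω} {M : Ω → Matrix (Fin n) (Fin n) ℝ} {u y : Ω → EuclideanSpace ℝ (Fin n)}
    (hM : ∀ i j, Measurable fun ω => M ω i j) (hy : Measurable y)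
    (hdet : ∀ᵐ ω ∂μ, (M ω).det ≠ 0) (h : ∀ ω, Matrix.toEuclideanLin (M ω) (u ω) = y ω) :
    AEMeasurable u μ := by
  have hMm : Measurable fun ω => (fun i j => M ω i j : Fin n → Fin n → ℝ) :=
    measurable_pi_iff.2 fun i => measurable_pi_iff.2 fun j => hM i j
  have hcd : Continuous fun A : Fin n → Fin n → ℝ => (Matrix.of A).det :=
    Continuous.matrix_det continuous_id
  have hca : ∀ i j, Continuous fun A : Fin n → Fin n → ℝ => (Matrix.of A).adjugate i j :=
    fun i j => (Continuous.matrix_adjugate (A := fun A : Fin n → Fin n → ℝ => Matrix.of A)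
      continuous_id).matrix_elem i j
  have hd : Measurable fun ω => (M ω).det := hcd.measurable.comp hMm
  have ha : ∀ i j, Measurable fun ω => (M ω).adjugate i j :=
    fun i j => (hca i j).measurable.comp hMm
  have hyi : ∀ i, Measurable fun ω => y ω i := fun i => by fun_prop
  refine ⟨fun ω => WithLp.toLp 2 fun i => (M ω).det⁻¹ * ∑ j, (M ω).adjugate i j * y ω j, ?_, ?_⟩
  · refine (WithLp.measurable_toLp 2 _).comp (measurable_pi_iff.2 fun i => ?_)
    exact hd.inv.mul (Finset.measurable_sum _ fun j _ => (ha i j).mul (hyi j))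
  · filter_upwards [hdet] with ω hω
    have e : (M ω).adjugate.mulVec (y ω).ofLp = (M ω).det • (u ω).ofLp := by
      rw [← h ω, Matrix.ofLp_toLpLin, Matrix.toLin'_apply, Matrix.mulVec_mulVec, Matrix.adjugate_mul,
        Matrix.smul_mulVec, Matrix.one_mulVec]
    ext i
    have ei := congrFun e i
    simp only [Matrix.mulVec, dotProduct, Pi.smul_apply, smul_eq_mul] at ei
    simp [ei, hω]

/-- A matrix whose quadratic form is bounded below is nonsingular. -/
theorem Matrix.det_ne_zero_of_le_inner {n : ℕ} {M : Matrix (Fin n) (Fin n) ℝ} {a : ℝ} (ha : 0 < a)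
    (h : ∀ v : EuclideanSpace ℝ (Fin n), a * ‖v‖ ^ 2 ≤ ⟪Matrix.toEuclideanLin M v, v⟫) :
    M.det ≠ 0 := by
  intro hdet
  obtain ⟨v, hv, hMv⟩ := Matrix.exists_mulVec_eq_zero_iff.2 hdet
  have h1 := h (WithLp.toLp 2 v)
  rw [Matrix.toLpLin_toLp, Matrix.toLin'_apply, hMv, WithLp.toLp_zero, inner_zero_left] at h1
  have h2 : ‖WithLp.toLp 2 v‖ = 0 := by
    by_contra hne
    have : 0 < ‖WithLp.toLp 2 v‖ := lt_of_le_of_ne (norm_nonneg _) (Ne.symm hne)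
    have : 0 < a * ‖WithLp.toLp 2 v‖ ^ 2 := by positivity
    linarith
  exact hv (by simpa using h2)

/-- A linear map bounded below as a quadratic form is bounded below in norm. -/
theorem mul_norm_le_norm_of_le_inner {E : Type*} [NormedAddCommGroup E] [InnerProductSpace ℝ E]
    {a : ℝ} {v y : E} (h : a * ‖v‖ ^ 2 ≤ ⟪y, v⟫) : a * ‖v‖ ≤ ‖y‖ := by
  rcases (norm_nonneg v).eq_or_lt with hv | hv
  · simp [← hv]
  · have := real_inner_le_norm y v
    exact le_of_mul_le_mul_right (by nlinarith) hv

/-- Almost-sure convergence of the (VS-SQN) scheme under strong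
convexity with summable inverse batch sizes. -/
theorem vs_sqn_as_convergence
    {n : ℕ} {Ω : Type*} {m0 : MeasurableSpace Ω} (P : Measure Ω) [IsProbabilityMeasure P]
    (ℱ : Filtration ℕ m0)
    (f : EuclideanSpace ℝ (Fin n) → ℝ) (gf : EuclideanSpace ℝ (Fin n) → EuclideanSpace ℝ (Fin n))
    (τ L lam ulam ν₁ ν₂ : ℝ)
    (hτ : 0 < τ) (hL : 0 < L) (hlam : 0 < lam) (hlamle : lam ≤ ulam)
    (hν₁ : 0 < ν₁) (hν₂ : 0 < ν₂)
    (hsc : StrongConvexOn Set.univ τ f)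
    (hgrad : ∀ z, HasGradientAt f (gf z) z)
    (hlip : ∀ z z', ‖gf z - gf z'‖ ≤ L * ‖z - z'‖)
    (xstar : EuclideanSpace ℝ (Fin n)) (hmin : ∀ z, f xstar ≤ f z)
    (x w : ℕ → Ω → EuclideanSpace ℝ (Fin n))
    (H : ℕ → Ω → Matrix (Fin n) (Fin n) ℝ)
    (γ : ℕ → ℝ) (N : ℕ → ℕ)
    (hx_meas : ∀ k, Measurable[ℱ k] (x k))
    (hf_int : ∀ k, Integrable (fun ω => f (x k ω)) P)
    (hH_meas : ∀ k, ∀ i j, Measurable[ℱ k] fun ω => H k ω i j)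
    (hH_symm : ∀ k, ∀ᵐ ω ∂P, (H k ω).IsSymm)
    (hH_bnd : ∀ k, ∀ᵐ ω ∂P, ∀ v : EuclideanSpace ℝ (Fin n),
      lam * ‖v‖ ^ 2 ≤ ⟪(Matrix.toEuclideanLin (H k ω)) v, v⟫ ∧
      ⟪(Matrix.toEuclideanLin (H k ω)) v, v⟫ ≤ ulam * ‖v‖ ^ 2)
    (hw_mean : ∀ k, P[w k | ℱ k] =ᵐ[P] 0)
    (hw_var : ∀ k, ∀ᵐ ω ∂P,
      (P[fun ω' => ‖w k ω'‖ ^ 2 | ℱ k]) ω ≤ (ν₁ ^ 2 * ‖x k ω‖ ^ 2 + ν₂ ^ 2) / (N k))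
    (hupdate : ∀ k ω, x (k + 1) ω
      = x k ω - γ k • (Matrix.toEuclideanLin (H k ω)) (gf (x k ω) + w k ω))
    (hγ : ∀ k, γ k = 1 / (L * ulam))
    (hNpos : ∀ k, 0 < N k) (hNmono : Monotone N)
    (hNsum : Summable fun k => (1 : ℝ) / N k)
    (hN0 : 2 * ν₁ ^ 2 * ulam / (τ ^ 2 * lam) < (N 0 : ℝ)) :
    ∀ᵐ ω ∂P, Tendsto (fun k => f (x k ω)) atTop (𝓝 (f xstar)) ∧
      Tendsto (fun k => ‖x k ω - xstar‖ ^ 2) atTop (𝓝 0) := by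
  have hulam : 0 < ulam := hlam.trans_le hlamle
  have hxm : ∀ k, Measurable (x k) := fun k => (hx_meas k).mono (ℱ.le k) le_rfl
  have hgfc : Continuous gf :=
    (LipschitzWith.of_dist_le' (K := L) fun z z' => by
      simpa [dist_eq_norm] using hlip z z').continuous
  have hgs : gf xstar = 0 := by
    have h : IsLocalMin f xstar := Eventually.of_forall hmin
    simpa using h.hasFDerivAt_eq_zero (hgrad xstar).hasFDerivAt
  have hgrow : ∀ z, ‖z - xstar‖ ^ 2 ≤ 2 / τ * (f z - f xstar) := fun z => by
    have h := hsc.add_inner_add_le (hgrad xstar) z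
    rw [hgs, inner_zero_left] at h
    rw [div_mul_eq_mul_div, le_div_iff₀ hτ]
    linarith
  have hD0 : ∀ k ω, 0 ≤ f (x k ω) - f xstar := fun k ω => sub_nonneg.2 (hmin _)
  have hDint : ∀ k, Integrable (fun ω => f (x k ω) - f xstar) P :=
    fun k => (hf_int k).sub (integrable_const _)
  have hx2 : ∀ k, MemLp (fun ω => x k ω - xstar) 2 P := fun k => by
    have hm : AEStronglyMeasurable (fun ω => x k ω - xstar) P :=
      ((hxm k).sub_const xstar).aestronglyMeasurable
    rw [memLp_two_iff_integrable_sq_norm hm]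
    refine ((hDint k).const_mul (2 / τ)).mono' (hm.norm.pow 2) (ae_of_all _ fun ω => ?_)
    rw [Real.norm_of_nonneg (by positivity)]
    exact hgrow _
  have hg2 : ∀ k, MemLp (fun ω => gf (x k ω)) 2 P := fun k =>
    (hx2 k).of_le_mul (c := L) (hgfc.measurable.comp (hxm k)).aestronglyMeasurable
      (ae_of_all _ fun ω => by simpa [hgs] using hlip (x k ω) xstar)
  have hHu : ∀ k ω, Matrix.toEuclideanLin (H k ω) (gf (x k ω) + w k ω)
      = (L * ulam) • (x k ω - x (k + 1) ω) := fun k ω => by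
    rw [hupdate, hγ, sub_sub_cancel, smul_smul, mul_one_div_cancel (by positivity), one_smul]
  have hu2 : ∀ k, MemLp (fun ω => gf (x k ω) + w k ω) 2 P := fun k => by
    have hm : AEMeasurable (fun ω => gf (x k ω) + w k ω) P :=
      aemeasurable_of_toEuclideanLin_eq (fun i j => (hH_meas k i j).mono (ℱ.le k) le_rfl)
        (((hxm k).sub (hxm (k + 1))).const_smul (L * ulam))
        ((hH_bnd k).mono fun ω h => Matrix.det_ne_zero_of_le_inner hlam fun v => (h v).1) (hHu k)
    refine ((hx2 k).sub (hx2 (k + 1))).of_le_mul (c := L * ulam / lam) hm.aestronglyMeasurable ?_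
    filter_upwards [hH_bnd k] with ω h
    have h1 := mul_norm_le_norm_of_le_inner (h (gf (x k ω) + w k ω)).1
    rw [hHu, norm_smul, Real.norm_of_nonneg (by positivity)] at h1
    rw [div_mul_eq_mul_div, le_div_iff₀' hlam]
    simpa using h1
  have hw2 : ∀ k, Integrable (fun ω => ‖w k ω‖ ^ 2) P := fun k => by
    have h : MemLp (w k) 2 P := by
      simpa [Pi.sub_def] using (hu2 k).sub (hg2 k)
    exact (memLp_two_iff_integrable_sq_norm h.1).1 h
  have hstep : ∀ k, ∀ᵐ ω ∂P, f (x (k + 1) ω) - f xstar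
      ≤ (1 - lam * τ / (L * ulam)) * (f (x k ω) - f xstar) + 1 / (2 * L) * ‖w k ω‖ ^ 2 := by
    intro k
    filter_upwards [hH_symm k, hH_bnd k] with ω hs hb
    rw [hupdate, hγ]
    refine sub_le_of_preconditioned_gradient_step hτ hL hlam hulam hsc hgrad hlip
      (Matrix.isSymmetric_toEuclideanLin_iff.2 ?_) hb _ _ _
    rwa [Matrix.IsHermitian, Matrix.conjTranspose_eq_transpose_of_trivial]
  have hnoise : ∀ k, ∫ ω, ‖w k ω‖ ^ 2 ∂P ≤ 1 / (N k : ℝ) *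
      (ν₁ ^ 2 * (4 / τ) * ∫ ω, (f (x k ω) - f xstar) ∂P
        + (2 * ν₁ ^ 2 * ‖xstar‖ ^ 2 + ν₂ ^ 2)) := fun k => by
    rw [← integral_condExp (ℱ.le k)]
    calc ∫ ω, (P[fun ω' => ‖w k ω'‖ ^ 2 | ℱ k]) ω ∂P
        ≤ ∫ ω, 1 / (N k : ℝ) * (ν₁ ^ 2 * (4 / τ) * (f (x k ω) - f xstar)
            + (2 * ν₁ ^ 2 * ‖xstar‖ ^ 2 + ν₂ ^ 2)) ∂P := by
          refine integral_mono_ae integrable_condExp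
            ((((hDint k).const_mul _).add (integrable_const _)).const_mul _) ?_
          filter_upwards [hw_var k] with ω h
          refine h.trans ?_
          rw [div_eq_inv_mul, ← one_div]
          gcongr ?_ * ?_
          have h1 : ‖x k ω‖ ^ 2 ≤ 2 * ‖x k ω - xstar‖ ^ 2 + 2 * ‖xstar‖ ^ 2 := by
            have h2 := norm_add_le (x k ω - xstar) xstar
            rw [sub_add_cancel] at h2
            nlinarith [norm_nonneg (x k ω), sq_nonneg (‖x k ω - xstar‖ - ‖xstar‖)]
          have h3 : ‖x k ω‖ ^ 2 ≤ 4 / τ * (f (x k ω) - f xstar) + 2 * ‖xstar‖ ^ 2 := by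
            have h4 := hgrow (x k ω)
            have e : 4 / τ = 2 * (2 / τ) := by ring
            rw [e]
            linarith
          nlinarith [mul_le_mul_of_nonneg_left h3 (sq_nonneg ν₁)]
      _ = _ := by
          rw [integral_const_mul, integral_add ((hDint k).const_mul _) (integrable_const _),
            integral_const_mul]
          simp
  have hsum : Summable fun k => ∫ ω, (f (x k ω) - f xstar) ∂P := by
    refine summable_of_contracting_recursion (s := fun k => 1 / (N k : ℝ))
      (q := lam * τ / (L * ulam)) (A := 1 / (2 * L) * (ν₁ ^ 2 * (4 / τ)))
      (B := 1 / (2 * L) * (2 * ν₁ ^ 2 * ‖xstar‖ ^ 2 + ν₂ ^ 2)) (by positivity) (by positivity)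
      (fun k => integral_nonneg (hD0 k)) (fun k => by positivity) hNsum fun k => ?_
    have h1 := integral_mono_ae (hDint (k + 1))
      (((hDint k).const_mul _).add ((hw2 k).const_mul _)) (hstep k)
    rw [integral_add' ((hDint k).const_mul _) ((hw2 k).const_mul _), integral_const_mul,
      integral_const_mul] at h1
    have h2 := mul_le_mul_of_nonneg_left (hnoise k) (by positivity : 0 ≤ 1 / (2 * L))
    linarith
  filter_upwards [ae_tendsto_zero_of_summable_integral hDint hD0 hsum] with ω hω
  refine ⟨tendsto_sub_nhds_zero_iff.1 hω, ?_⟩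
  refine squeeze_zero (fun k => by positivity) (fun k => hgrow (x k ω)) ?_
  simpa using hω.const_mul (2 / τ)
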